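/- arXiv:2605.12664 — 8 statements merged into one kernel-verified Lean document; each statement's English description precedes it below -/
import Mathlib

section
/- Let A ⊆ [0,1]^2 be a closed set and let p,q : [0,1]^2 → [0,1] satisfy p(v) = q(v) = 0 for all v ∉ A. Define, for a seller with valuation vs and a buyer with valuation vb bidding (bs,bb) ∈ [0,1]^2, the utilities u_s(vs,(bs,bb)) = vs·(1 − 1{(bs,bb) ∈ A}) + p(bs,bb) and u_b(vb,(bs,bb)) = vb·1{(bs,bb) ∈ A} − q(bs,bb). Say the mechanism (A,p,q) is DSIC if u_s(vs,(vs,bb)) ≥ u_s(vs,(bs,bb)) for all vs ∈ [0,1] and (bs,bb) ∈ [0,1]^2, and u_b(vb,(bs,vb)) ≥ u_b(vb,(bs,bb)) for all vb ∈ [0,1] and (bs,bb) ∈ [0,1]^2; say it is IR if u_s(vs,(vs,bb)) ≥ vs for all vs,bb ∈ [0,1] and u_b(vb,(bs,vb)) ≥ 0 for all vb,bs ∈ [0,1]. Then (A,p,q) is DSIC and IR if and only if A is monotone and p = p_A, q = q_A are the Myerson payments of A. -/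
open MeasureTheory Set
open scoped Classical

noncomputable section

/-- The unit square `[0,1]²` of valuation pairs. -/
def square : Set (ℝ × ℝ) := Set.Icc (0:ℝ) 1 ×ˢ Set.Icc (0:ℝ) 1

/-- A (bilateral-trade) monotone allocation region: a closed subset of the unit square,
closed in the north-west direction. -/
def IsAllocRegion (A : Set (ℝ × ℝ)) : Prop :=
  IsClosed A ∧ A ⊆ square ∧
    ∀ x ∈ A, ∀ y ∈ square, y.1 ≤ x.1 → x.2 ≤ y.2 → y ∈ A

/-- Myerson seller payment `p_A`. -/
def sellerPay (A : Set (ℝ × ℝ)) (v : ℝ × ℝ) : ℝ :=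
  if v ∈ A then sSup {x : ℝ | x ∈ Set.Icc (0:ℝ) 1 ∧ (x, v.2) ∈ A} else 0

/-- Myerson buyer payment `q_A`. -/
def buyerPay (A : Set (ℝ × ℝ)) (v : ℝ × ℝ) : ℝ :=
  if v ∈ A then sInf {y : ℝ | y ∈ Set.Icc (0:ℝ) 1 ∧ (v.1, y) ∈ A} else 0

/-- The broker's profit. -/
def profit (A : Set (ℝ × ℝ)) (v : ℝ × ℝ) : ℝ :=
  buyerPay A v - sellerPay A v

/-- The closed `ε`-tile with lower-left corner `(k/n, j/n)`, where `ε = 1/n`. -/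
def tile (n k j : ℕ) : Set (ℝ × ℝ) :=
  Set.Icc ((k : ℝ) / n) (((k : ℝ) + 1) / n) ×ˢ Set.Icc ((j : ℝ) / n) (((j : ℝ) + 1) / n)

/-- The `ε`-approximation `φ_ε(A)`: the union of all `ε`-tiles contained in `A`. -/
def gridApprox (n : ℕ) (A : Set (ℝ × ℝ)) : Set (ℝ × ℝ) :=
  ⋃ (k : Fin n) (j : Fin n) (_ : tile n k j ⊆ A), tile n k j

end

/-- Seller utility under mechanism `(A, p, ·)` when her valuation is `vs` and the bid
profile is `b`. -/
noncomputable def uS (A : Set (ℝ × ℝ)) (p : ℝ × ℝ → ℝ) (vs : ℝ) (b : ℝ × ℝ) : ℝ :=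
  vs * (1 - (if b ∈ A then (1:ℝ) else 0)) + p b

/-- Buyer utility under mechanism `(A, ·, q)` when his valuation is `vb` and the bid
profile is `b`. -/
noncomputable def uB (A : Set (ℝ × ℝ)) (q : ℝ × ℝ → ℝ) (vb : ℝ) (b : ℝ × ℝ) : ℝ :=
  vb * (if b ∈ A then (1:ℝ) else 0) - q b

/-- Dominant-strategy incentive compatibility of the mechanism `(A, p, q)`. -/
def DSIC (A : Set (ℝ × ℝ)) (p q : ℝ × ℝ → ℝ) : Prop :=
  (∀ vs ∈ Set.Icc (0:ℝ) 1, ∀ b ∈ square, uS A p vs (vs, b.2) ≥ uS A p vs b) ∧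
  (∀ vb ∈ Set.Icc (0:ℝ) 1, ∀ b ∈ square, uB A q vb (b.1, vb) ≥ uB A q vb b)

/-- Individual rationality of the mechanism `(A, p, q)`. -/
def IR (A : Set (ℝ × ℝ)) (p q : ℝ × ℝ → ℝ) : Prop :=
  (∀ vs ∈ Set.Icc (0:ℝ) 1, ∀ bb ∈ Set.Icc (0:ℝ) 1, uS A p vs (vs, bb) ≥ vs) ∧
  (∀ vb ∈ Set.Icc (0:ℝ) 1, ∀ bs ∈ Set.Icc (0:ℝ) 1, uB A q vb (bs, vb) ≥ 0)

/-- At a trading profile, the Myerson seller payment is the largest seller bid that still trades. -/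
theorem isGreatest_sellerPay {A : Set (ℝ × ℝ)} (hA : IsClosed A) (hAsq : A ⊆ square)
    {v : ℝ × ℝ} (hv : v ∈ A) :
    IsGreatest {x : ℝ | x ∈ Icc (0 : ℝ) 1 ∧ (x, v.2) ∈ A} (sellerPay A v) := by
  rw [sellerPay, if_pos hv]
  refine IsCompact.isGreatest_sSup ?_ ⟨v.1, (hAsq hv).1, hv⟩
  exact isCompact_Icc.inter_right (hA.preimage (by fun_prop : Continuous fun x : ℝ => (x, v.2)))

/-- At a trading profile, the Myerson buyer payment is the smallest buyer bid that still trades. -/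
theorem isLeast_buyerPay {A : Set (ℝ × ℝ)} (hA : IsClosed A) (hAsq : A ⊆ square)
    {v : ℝ × ℝ} (hv : v ∈ A) :
    IsLeast {y : ℝ | y ∈ Icc (0 : ℝ) 1 ∧ (v.1, y) ∈ A} (buyerPay A v) := by
  rw [buyerPay, if_pos hv]
  refine IsCompact.isLeast_sInf ?_ ⟨v.2, (hAsq hv).2, hv⟩
  exact isCompact_Icc.inter_right (hA.preimage (by fun_prop : Continuous fun y : ℝ => (v.1, y)))

theorem uS_of_mem {A : Set (ℝ × ℝ)} {p : ℝ × ℝ → ℝ} {vs : ℝ} {b : ℝ × ℝ} (hb : b ∈ A) :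
    uS A p vs b = p b := by simp [uS, hb]

theorem uS_of_notMem {A : Set (ℝ × ℝ)} {p : ℝ × ℝ → ℝ} {vs : ℝ} {b : ℝ × ℝ} (hb : b ∉ A) :
    uS A p vs b = vs + p b := by simp [uS, hb]

theorem uB_of_mem {A : Set (ℝ × ℝ)} {q : ℝ × ℝ → ℝ} {vb : ℝ} {b : ℝ × ℝ} (hb : b ∈ A) :
    uB A q vb b = vb - q b := by simp [uB, hb]

theorem uB_of_notMem {A : Set (ℝ × ℝ)} {q : ℝ × ℝ → ℝ} {vb : ℝ} {b : ℝ × ℝ} (hb : b ∉ A) :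
    uB A q vb b = -q b := by simp [uB, hb]

/-- a bilateral-trade mechanism is DSIC and IR if and only if its
allocation region is monotone and its payments are the Myerson payments. -/
theorem dsic_ir_characterization (A : Set (ℝ × ℝ)) (p q : ℝ × ℝ → ℝ)
    (hAclosed : IsClosed A) (hAsq : A ⊆ square)
    (hp : ∀ v ∈ square, p v ∈ Set.Icc (0:ℝ) 1)
    (hq : ∀ v ∈ square, q v ∈ Set.Icc (0:ℝ) 1)
    (hp0 : ∀ v ∈ square, v ∉ A → p v = 0)
    (hq0 : ∀ v ∈ square, v ∉ A → q v = 0) :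
    (DSIC A p q ∧ IR A p q) ↔
      ((∀ x ∈ A, ∀ y ∈ square, y.1 ≤ x.1 → x.2 ≤ y.2 → y ∈ A) ∧
        ∀ v ∈ square, p v = sellerPay A v ∧ q v = buyerPay A v) := by
  constructor
  · rintro ⟨⟨hS, hB⟩, hSI, hBI⟩
    have p_ge : ∀ v ∈ A, v.1 ≤ p v := fun v hv => by
      simpa [uS_of_mem hv] using hSI v.1 (hAsq hv).1 v.2 (hAsq hv).2
    have q_le : ∀ v ∈ A, q v ≤ v.2 := fun v hv => by
      simpa [uB_of_mem hv] using hBI v.2 (hAsq hv).2 v.1 (hAsq hv).1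
    have p_le : ∀ v ∈ A, ∀ x ∈ Icc (0 : ℝ) 1, (x, v.2) ∉ A → p v ≤ x := fun v hv x hx hxA => by
      simpa [uS_of_mem hv, uS_of_notMem hxA, hp0 (x, v.2) ⟨hx, (hAsq hv).2⟩ hxA]
        using hS x hx v (hAsq hv)
    have q_ge : ∀ v ∈ A, ∀ y ∈ Icc (0 : ℝ) 1, (v.1, y) ∉ A → y ≤ q v := fun v hv y hy hyA => by
      simpa [uB_of_mem hv, uB_of_notMem hyA, hq0 (v.1, y) ⟨(hAsq hv).1, hy⟩ hyA]
        using hB y hy v (hAsq hv)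
    refine ⟨fun x hx y hy h1 h2 => ?_, fun v hv => ?_⟩
    · have h : (y.1, x.2) ∈ A := by
        by_contra h
        have heq : y.1 = x.1 := le_antisymm h1 ((p_ge x hx).trans (p_le x hx _ hy.1 h))
        exact h (heq ▸ hx)
      by_contra h'
      have heq : x.2 = y.2 := le_antisymm h2 ((q_ge _ h _ hy.2 h').trans (q_le _ h))
      exact h' (by simpa [heq] using h)
    · by_cases hvA : v ∈ A
      swap
      · simp [sellerPay, buyerPay, hvA, hp0 v hv hvA, hq0 v hv hvA]
      constructor
      · obtain ⟨⟨hm, hmA⟩, hmax⟩ := isGreatest_sellerPay hAclosed hAsq hvA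
        set m := sellerPay A v
        refine le_antisymm (le_of_not_gt fun hlt => ?_) ?_
        · have hx : (p v + m) / 2 ∈ Icc (0 : ℝ) 1 :=
            ⟨by linarith [(hp v hv).1, hm.1], by linarith [(hp v hv).2, hm.2]⟩
          have hxA : ((p v + m) / 2, v.2) ∉ A := fun h => by linarith [hmax ⟨hx, h⟩]
          linarith [p_le v hvA _ hx hxA]
        · have h := hS v.1 hv.1 (m, v.2) ⟨hm, hv.2⟩
          rw [uS_of_mem hmA, uS_of_mem (by exact hvA)] at h
          exact (p_ge _ hmA).trans h
      · obtain ⟨⟨hm, hmA⟩, hmin⟩ := isLeast_buyerPay hAclosed hAsq hvA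
        set m := buyerPay A v
        refine le_antisymm ?_ (le_of_not_gt fun hlt => ?_)
        · have h := hB v.2 hv.2 (v.1, m) ⟨hv.1, hm⟩
          rw [uB_of_mem hmA, uB_of_mem (by exact hvA)] at h
          have h' := q_le _ hmA
          simp only at h h'
          linarith
        · have hy : (q v + m) / 2 ∈ Icc (0 : ℝ) 1 :=
            ⟨by linarith [(hq v hv).1, hm.1], by linarith [(hq v hv).2, hm.2]⟩
          have hyA : (v.1, (q v + m) / 2) ∉ A := fun h => by linarith [hmin ⟨hy, h⟩]
          linarith [q_ge v hvA _ hy hyA]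
  · rintro ⟨hmono, hpay⟩
    have p_ge : ∀ v ∈ A, v.1 ≤ p v := fun v hv =>
      (hpay v (hAsq hv)).1 ▸ (isGreatest_sellerPay hAclosed hAsq hv).2 ⟨(hAsq hv).1, hv⟩
    have q_le : ∀ v ∈ A, q v ≤ v.2 := fun v hv =>
      (hpay v (hAsq hv)).2 ▸ (isLeast_buyerPay hAclosed hAsq hv).2 ⟨(hAsq hv).2, hv⟩
    refine ⟨⟨fun vs hvs b hb => ?_, fun vb hvb b hb => ?_⟩,
      fun vs hvs bb hbb => ?_, fun vb hvb bs hbs => ?_⟩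
    · have hb' : (vs, b.2) ∈ square := ⟨hvs, hb.2⟩
      by_cases h1 : (vs, b.2) ∈ A <;> by_cases h2 : b ∈ A
      · rw [uS_of_mem h1, uS_of_mem h2, (hpay _ hb').1, (hpay b hb).1]
        simp [sellerPay, h1, h2]
      · rw [uS_of_mem h1, uS_of_notMem h2, hp0 b hb h2, add_zero]
        exact p_ge _ h1
      · rw [uS_of_notMem h1, uS_of_mem h2, hp0 _ hb' h1, add_zero, (hpay b hb).1]
        obtain ⟨-, hmA⟩ := (isGreatest_sellerPay hAclosed hAsq h2).1
        exact le_of_not_gt fun hlt => h1 (hmono _ hmA _ hb' hlt.le le_rfl)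
      · rw [uS_of_notMem h1, uS_of_notMem h2, hp0 _ hb' h1, hp0 b hb h2]
    · have hb' : (b.1, vb) ∈ square := ⟨hb.1, hvb⟩
      by_cases h1 : (b.1, vb) ∈ A <;> by_cases h2 : b ∈ A
      · rw [uB_of_mem h1, uB_of_mem h2, (hpay _ hb').2, (hpay b hb).2]
        simp [buyerPay, h1, h2]
      · rw [uB_of_mem h1, uB_of_notMem h2, hq0 b hb h2, neg_zero]
        exact sub_nonneg.2 (q_le _ h1)
      · rw [uB_of_notMem h1, uB_of_mem h2, hq0 _ hb' h1, neg_zero, (hpay b hb).2]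
        obtain ⟨-, hmA⟩ := (isLeast_buyerPay hAclosed hAsq h2).1
        exact sub_nonpos.2 (le_of_not_gt fun hlt => h1 (hmono _ hmA _ hb' le_rfl hlt.le))
      · rw [uB_of_notMem h1, uB_of_notMem h2, hq0 _ hb' h1, hq0 b hb h2]
    · by_cases h : (vs, bb) ∈ A
      · rw [uS_of_mem h]
        exact p_ge _ h
      · rw [uS_of_notMem h, hp0 _ ⟨hvs, hbb⟩ h, add_zero]
    · by_cases h : (bs, vb) ∈ A
      · rw [uB_of_mem h]
        exact sub_nonneg.2 (q_le _ h)
      · rw [uB_of_notMem h, hq0 _ ⟨hbs, hvb⟩ h, neg_zero]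
end

section
/- Let σ ∈ (0,1], let μ be a σ-smooth Borel probability measure on [0,1]^2, let A be a monotone allocation region, let n ≥ 1 be an integer and ε = 1/n. Then the expected absolute difference of profits between A and its ε-approximation satisfies ∫_{[0,1]^2} |profit(A,v) − profit(φ_ε(A),v)| dμ(v) ≤ 6ε/σ. -/
open MeasureTheory Set
open scoped Classical

/-- Lebesgue measure on the unit interval. -/
local notation "ℓ" => (volume.restrict (Set.Icc (0:ℝ) 1) : Measure ℝ)

lemma isProbabilityMeasure_restrict_Icc : IsProbabilityMeasure ℓ :=
  ⟨by simp⟩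

lemma volume_restrict_square :
    (volume : Measure (ℝ × ℝ)).restrict square = Measure.prod ℓ ℓ := by
  rw [square, Measure.prod_restrict, Measure.volume_eq_prod]

lemma measurableSet_square : MeasurableSet square :=
  measurableSet_Icc.prod measurableSet_Icc

lemma isClosed_tile (n k j : ℕ) : IsClosed (tile n k j) :=
  isClosed_Icc.prod isClosed_Icc

lemma isClosed_gridApprox (n : ℕ) (A : Set (ℝ × ℝ)) : IsClosed (gridApprox n A) :=
  isClosed_iUnion_of_finite fun k => isClosed_iUnion_of_finite fun j =>
    isClosed_iUnion_of_finite fun _ => isClosed_tile n k j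

lemma gridApprox_subset (n : ℕ) (A : Set (ℝ × ℝ)) : gridApprox n A ⊆ A :=
  iUnion_subset fun _ => iUnion_subset fun _ => iUnion_subset fun h => h

lemma exists_mem_Icc_div {n : ℕ} (hn : 1 ≤ n) {x : ℝ} (hx : x ∈ Set.Icc (0:ℝ) 1) :
    ∃ k : Fin n, x ∈ Set.Icc ((k : ℝ) / n) (((k : ℝ) + 1) / n) := by
  have hn0 : (0:ℝ) < n := by exact_mod_cast hn
  rcases lt_or_ge (⌊x * n⌋₊) n with h | h
  · refine ⟨⟨_, h⟩, ?_, ?_⟩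
    · rw [div_le_iff₀ hn0]
      exact Nat.floor_le (mul_nonneg hx.1 hn0.le)
    · rw [le_div_iff₀ hn0]
      exact (Nat.lt_floor_add_one _).le
  · have hx1 : x = 1 := by
      have h1 : (n : ℝ) ≤ x * n :=
        (Nat.cast_le.2 h).trans (Nat.floor_le (mul_nonneg hx.1 hn0.le))
      exact le_antisymm hx.2 (by nlinarith)
    refine ⟨⟨n - 1, by omega⟩, ?_, ?_⟩
    · rw [div_le_iff₀ hn0, hx1]
      push_cast [hn]
      linarith
    · rw [le_div_iff₀ hn0, hx1]
      push_cast [hn]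
      linarith

lemma tile_subset_square {n : ℕ} (k j : Fin n) : tile n k j ⊆ square := by
  have key : ∀ (i : Fin n) (x : ℝ), x ∈ Set.Icc ((i : ℝ) / n) (((i : ℝ) + 1) / n) →
      x ∈ Set.Icc (0:ℝ) 1 := by
    intro i x hx
    have hn0 : (0:ℝ) < n := by exact_mod_cast i.pos
    refine ⟨le_trans (by positivity) hx.1, hx.2.trans ?_⟩
    rw [div_le_one hn0]
    exact_mod_cast i.isLt
  rintro v ⟨h1, h2⟩
  exact ⟨key k _ h1, key j _ h2⟩

/-- A tile lying weakly north-west of a tile that meets a monotone region is contained in it. -/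
lemma IsAllocRegion.tile_subset {A : Set (ℝ × ℝ)} (hA : IsAllocRegion A) {n : ℕ}
    {k j k' j' : Fin n} (hk : k < k') (hj : j' < j) (h : (tile n k' j' ∩ A).Nonempty) :
    tile n k j ⊆ A := by
  obtain ⟨x, ⟨hx1, hx2⟩, hxA⟩ := h
  intro y hy
  have hn0 : (0:ℝ) < n := by exact_mod_cast k.pos
  have hk' : ((k : ℝ) + 1) / n ≤ (k' : ℝ) / n := by
    gcongr
    exact_mod_cast hk
  have hj' : ((j' : ℝ) + 1) / n ≤ (j : ℝ) / n := by
    gcongr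
    exact_mod_cast hj
  exact hA.2.2 x hxA y (tile_subset_square k j hy) (hy.1.2.trans (hk'.trans hx1.1))
    (hx2.2.trans (hj'.trans hy.2.1))

/-- The tiles that meet `A` without being contained in it. -/
noncomputable def boundaryTiles (n : ℕ) (A : Set (ℝ × ℝ)) : Finset (Fin n × Fin n) :=
  {p | (tile n p.1 p.2 ∩ A).Nonempty ∧ ¬ tile n p.1 p.2 ⊆ A}

lemma card_boundaryTiles_le {A : Set (ℝ × ℝ)} (hA : IsAllocRegion A) (n : ℕ) :
    (boundaryTiles n A).card ≤ 2 * n := by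
  rw [← Finset.card_range (2 * n)]
  refine Finset.card_le_card_of_injOn (fun p => (p.1 : ℕ) + p.2) ?_ ?_
  · intro p _
    have := p.1.isLt
    have := p.2.isLt
    simp only [Finset.coe_range, Set.mem_Iio]
    omega
  · rintro ⟨k, j⟩ hp ⟨k', j'⟩ hp' h
    simp only [boundaryTiles, Finset.coe_filter, Finset.mem_univ, true_and,
      Set.mem_ofPred_eq] at hp hp' h
    rcases lt_trichotomy k k' with hk | hk | hk
    · exact absurd (hA.tile_subset hk (Fin.lt_def.2 (by omega)) hp'.1) hp.2
    · subst hk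
      exact Prod.ext rfl (Fin.ext (by simpa using h))
    · exact absurd (hA.tile_subset hk (Fin.lt_def.2 (by omega)) hp.1) hp'.2

lemma diff_gridApprox_subset {A : Set (ℝ × ℝ)} (hA : A ⊆ square) {n : ℕ} (hn : 1 ≤ n) :
    A \ gridApprox n A ⊆ ⋃ p ∈ boundaryTiles n A, tile n p.1 p.2 := by
  rintro v ⟨hvA, hvB⟩
  obtain ⟨k, hk⟩ := exists_mem_Icc_div hn (hA hvA).1
  obtain ⟨j, hj⟩ := exists_mem_Icc_div hn (hA hvA).2
  have hv : v ∈ tile n k j := ⟨hk, hj⟩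
  refine mem_biUnion (x := (k, j)) ?_ hv
  simp only [boundaryTiles, Finset.coe_filter, Finset.mem_univ, true_and, Set.mem_ofPred_eq]
  refine ⟨⟨v, hv, hvA⟩, fun hsub => hvB ?_⟩
  exact mem_iUnion.2 ⟨k, mem_iUnion.2 ⟨j, mem_iUnion.2 ⟨hsub, hv⟩⟩⟩

lemma volume_tile (n k j : ℕ) :
    volume (tile n k j) = ENNReal.ofReal (1 / n) * ENNReal.ofReal (1 / n) := by
  rw [tile, Measure.volume_eq_prod, Measure.prod_prod, Real.volume_Icc, Real.volume_Icc,
    ← sub_div, ← sub_div, add_sub_cancel_left, add_sub_cancel_left]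

lemma volume_diff_gridApprox_le {A : Set (ℝ × ℝ)} (hA : IsAllocRegion A) {n : ℕ} (hn : 1 ≤ n) :
    volume (A \ gridApprox n A) ≤ ENNReal.ofReal (2 * (1 / n)) := by
  have hn0 : (0:ℝ) < n := by exact_mod_cast hn
  calc volume (A \ gridApprox n A)
      ≤ ∑ p ∈ boundaryTiles n A, volume (tile n p.1 p.2) :=
        (measure_mono (diff_gridApprox_subset hA.2.1 hn)).trans
          (measure_biUnion_finset_le _ _)
    _ = (boundaryTiles n A).card * ENNReal.ofReal (1 / n * (1 / n)) := by
        simp only [volume_tile, Finset.sum_const, nsmul_eq_mul]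
        rw [ENNReal.ofReal_mul (by positivity)]
    _ ≤ ((2 * n : ℕ) : ENNReal) * ENNReal.ofReal (1 / n * (1 / n)) := by
        gcongr
        exact card_boundaryTiles_le hA n
    _ = ENNReal.ofReal (2 * (1 / n)) := by
        rw [← ENNReal.ofReal_natCast, ← ENNReal.ofReal_mul (by positivity)]
        congr 1
        push_cast
        field_simp

lemma sellerPay_mem_Icc (A : Set (ℝ × ℝ)) (v : ℝ × ℝ) : sellerPay A v ∈ Set.Icc (0:ℝ) 1 := by
  unfold sellerPay
  split_ifs
  · exact ⟨Real.sSup_nonneg fun x hx => hx.1.1, Real.sSup_le (fun x hx => hx.1.2) zero_le_one⟩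
  · simp

lemma buyerPay_mem_Icc {A : Set (ℝ × ℝ)} (hA : A ⊆ square) (v : ℝ × ℝ) :
    buyerPay A v ∈ Set.Icc (0:ℝ) 1 := by
  unfold buyerPay
  split_ifs with h
  · refine ⟨Real.sInf_nonneg fun x hx => hx.1.1, ?_⟩
    exact csInf_le_of_le ⟨0, fun x hx => hx.1.1⟩ ⟨(hA h).2, h⟩ (hA h).2.2
  · simp

lemma ofReal_abs_sellerPay_sub_le {A B : Set (ℝ × ℝ)} (hA : IsAllocRegion A) (hBA : B ⊆ A)
    {v : ℝ × ℝ} (hv : v ∈ B) :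
    ENNReal.ofReal |sellerPay A v - sellerPay B v| ≤ ℓ ((fun x => (x, v.2)) ⁻¹' (A \ B)) := by
  have hvA := hBA hv
  have hvs := hA.2.1 hvA
  have hle : sellerPay B v ≤ sellerPay A v := by
    simp only [sellerPay, hv, hvA, if_true]
    exact csSup_le_csSup ⟨1, fun x hx => hx.1.2⟩ (by exact ⟨v.1, hvs.1, hv⟩)
      fun x hx => ⟨hx.1, hBA hx.2⟩
  rw [abs_of_nonneg (sub_nonneg.2 hle), ← Real.volume_Ioo,
    Measure.restrict_apply' measurableSet_Icc]
  refine measure_mono fun x hx => ?_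
  have hxI : x ∈ Set.Icc (0:ℝ) 1 :=
    ⟨(sellerPay_mem_Icc B v).1.trans hx.1.le, hx.2.le.trans (sellerPay_mem_Icc A v).2⟩
  simp only [sellerPay, hv, hvA, if_true] at hx
  refine ⟨⟨?_, fun hxB => ?_⟩, hxI⟩
  · obtain ⟨y, hy, hxy⟩ := exists_lt_of_lt_csSup (by exact ⟨v.1, hvs.1, hvA⟩) hx.2
    exact hA.2.2 _ hy.2 _ ⟨hxI, hvs.2⟩ hxy.le le_rfl
  · exact absurd hx.1 (not_lt.2 (le_csSup ⟨1, fun x hx => hx.1.2⟩ ⟨hxI, hxB⟩))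

lemma ofReal_abs_buyerPay_sub_le {A B : Set (ℝ × ℝ)} (hA : IsAllocRegion A) (hBA : B ⊆ A)
    {v : ℝ × ℝ} (hv : v ∈ B) :
    ENNReal.ofReal |buyerPay A v - buyerPay B v| ≤ ℓ (Prod.mk v.1 ⁻¹' (A \ B)) := by
  have hvA := hBA hv
  have hvs := hA.2.1 hvA
  have hle : buyerPay A v ≤ buyerPay B v := by
    simp only [buyerPay, hv, hvA, if_true]
    exact csInf_le_csInf ⟨0, fun x hx => hx.1.1⟩ ⟨v.2, hvs.2, hv⟩
      fun x hx => ⟨hx.1, hBA hx.2⟩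
  rw [abs_sub_comm, abs_of_nonneg (sub_nonneg.2 hle), ← Real.volume_Ioo,
    Measure.restrict_apply' measurableSet_Icc]
  refine measure_mono fun x hx => ?_
  have hxI : x ∈ Set.Icc (0:ℝ) 1 :=
    ⟨(buyerPay_mem_Icc hA.2.1 v).1.trans hx.1.le,
      hx.2.le.trans (buyerPay_mem_Icc (hBA.trans hA.2.1) v).2⟩
  simp only [buyerPay, hv, hvA, if_true] at hx
  refine ⟨⟨?_, fun hxB => ?_⟩, hxI⟩
  · obtain ⟨y, hy, hxy⟩ := exists_lt_of_csInf_lt (by exact ⟨v.2, hvs.2, hvA⟩) hx.1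
    exact hA.2.2 _ hy.2 _ ⟨hvs.1, hxI⟩ le_rfl hxy.le
  · exact absurd hx.2 (not_lt.2 (csInf_le ⟨0, fun x hx => hx.1.1⟩ ⟨hxI, hxB⟩))

lemma ofReal_abs_profit_sub_le {A B : Set (ℝ × ℝ)} (hA : IsAllocRegion A) (hBA : B ⊆ A)
    (v : ℝ × ℝ) :
    ENNReal.ofReal |profit A v - profit B v| ≤ (A \ B).indicator 1 v
      + ℓ ((fun x => (x, v.2)) ⁻¹' (A \ B)) + ℓ (Prod.mk v.1 ⁻¹' (A \ B)) := by
  by_cases hvB : v ∈ B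
  · calc ENNReal.ofReal |profit A v - profit B v|
        ≤ ENNReal.ofReal (|sellerPay A v - sellerPay B v| + |buyerPay A v - buyerPay B v|) := by
          refine ENNReal.ofReal_le_ofReal ?_
          have := abs_sub (buyerPay A v - buyerPay B v) (sellerPay A v - sellerPay B v)
          unfold profit
          rw [sub_sub_sub_comm]
          linarith
      _ ≤ ℓ ((fun x => (x, v.2)) ⁻¹' (A \ B)) + ℓ (Prod.mk v.1 ⁻¹' (A \ B)) := by
          rw [ENNReal.ofReal_add (abs_nonneg _) (abs_nonneg _)]
          exact add_le_add (ofReal_abs_sellerPay_sub_le hA hBA hvB)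
            (ofReal_abs_buyerPay_sub_le hA hBA hvB)
      _ ≤ _ := by
          rw [add_assoc]
          exact le_add_self
  · have hB : profit B v = 0 := by simp [profit, buyerPay, sellerPay, hvB]
    by_cases hvA : v ∈ A
    · rw [Set.indicator_of_mem (show v ∈ A \ B from ⟨hvA, hvB⟩), add_assoc]
      refine le_trans ?_ le_self_add
      rw [Pi.one_apply, ENNReal.ofReal_le_one, hB, sub_zero, profit, abs_le]
      have h1 := sellerPay_mem_Icc A v
      have h2 := buyerPay_mem_Icc hA.2.1 v
      constructor <;> linarith [h1.1, h1.2, h2.1, h2.2]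
    · have hA0 : profit A v = 0 := by simp [profit, buyerPay, sellerPay, hvA]
      simp [hA0, hB]

/-- Integrating the indicator of a set and the lengths of its horizontal and vertical slices over
the unit square gives three times its area there. -/
lemma lintegral_indicator_add_slices {D : Set (ℝ × ℝ)} (hD : MeasurableSet D) :
    ∫⁻ v in square, (D.indicator 1 v + ℓ ((fun x => (x, v.2)) ⁻¹' D) + ℓ (Prod.mk v.1 ⁻¹' D))
      = 3 * volume.restrict square D := by
  have := isProbabilityMeasure_restrict_Icc
  have m1 : Measurable fun y : ℝ => ℓ ((fun x => (x, y)) ⁻¹' D) :=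
    measurable_measure_prodMk_right hD
  have m2 : Measurable fun x : ℝ => ℓ (Prod.mk x ⁻¹' D) := measurable_measure_prodMk_left hD
  have m1' : Measurable fun v : ℝ × ℝ => ℓ ((fun x => (x, v.2)) ⁻¹' D) := m1.comp measurable_snd
  have m2' : Measurable fun v : ℝ × ℝ => ℓ (Prod.mk v.1 ⁻¹' D) := m2.comp measurable_fst
  rw [volume_restrict_square, lintegral_add_right _ m2', lintegral_add_right _ m1',
    lintegral_indicator_one hD,
    (measurePreserving_snd (μ := ℓ) (ν := ℓ)).lintegral_comp m1,
    (measurePreserving_fst (μ := ℓ) (ν := ℓ)).lintegral_comp m2,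
    ← Measure.prod_apply hD, ← Measure.prod_apply_symm hD]
  ring

lemma restrict_square_le_smul {c : ENNReal} {μ : Measure (ℝ × ℝ)}
    (h : ∀ E ⊆ square, MeasurableSet E → μ E ≤ volume E / c) :
    μ.restrict square ≤ c⁻¹ • volume.restrict square := by
  refine Measure.le_iff.2 fun E hE => ?_
  rw [Measure.smul_apply, Measure.restrict_apply hE, Measure.restrict_apply hE, smul_eq_mul,
    mul_comm, ← div_eq_mul_inv]
  exact h _ inter_subset_right (hE.inter measurableSet_square)

/-- under a σ-smooth distribution, the expected absolute profit difference
between a monotone allocation region and its ε-grid approximation is at most 6ε/σ. -/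
theorem l1_net (σ : ℝ) (hσ : σ ∈ Set.Ioc (0:ℝ) 1)
    (μ : MeasureTheory.Measure (ℝ × ℝ)) [MeasureTheory.IsProbabilityMeasure μ]
    (hsupp : μ squareᶜ = 0)
    (hsmooth : ∀ E ⊆ square, MeasurableSet E →
      μ E ≤ MeasureTheory.volume E / ENNReal.ofReal σ)
    (A : Set (ℝ × ℝ)) (hA : IsAllocRegion A)
    (n : ℕ) (hn : 1 ≤ n) :
    ∫ v in square, |profit A v - profit (gridApprox n A) v| ∂μ
      ≤ 6 * (1 / (n : ℝ)) / σ := by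
  have hn0 : (0:ℝ) < n := by exact_mod_cast hn
  have hσ0 := hσ.1
  set D := A \ gridApprox n A with hD
  have hDm : MeasurableSet D :=
    hA.1.measurableSet.diff (isClosed_gridApprox n A).measurableSet
  refine (Real.le_norm_self _).trans ((norm_integral_le_lintegral_norm _).trans ?_)
  refine ENNReal.toReal_le_of_le_ofReal (by positivity) ?_
  calc ∫⁻ v in square, ENNReal.ofReal ‖|profit A v - profit (gridApprox n A) v|‖ ∂μ
      ≤ ∫⁻ v, (D.indicator 1 v + ℓ ((fun x => (x, v.2)) ⁻¹' D) + ℓ (Prod.mk v.1 ⁻¹' D))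
          ∂((ENNReal.ofReal σ)⁻¹ • volume.restrict square) := by
        refine lintegral_mono' (restrict_square_le_smul hsmooth) fun v => ?_
        rw [Real.norm_eq_abs, abs_abs]
        exact ofReal_abs_profit_sub_le hA (gridApprox_subset n A) v
    _ = (ENNReal.ofReal σ)⁻¹ * (3 * volume.restrict square D) := by
        rw [lintegral_smul_measure, lintegral_indicator_add_slices hDm, smul_eq_mul]
    _ ≤ (ENNReal.ofReal σ)⁻¹ * (3 * ENNReal.ofReal (2 * (1 / n))) := by
        gcongr
        exact (Measure.restrict_apply_le _ _).trans (volume_diff_gridApprox_le hA hn)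
    _ = ENNReal.ofReal (6 * (1 / (n : ℝ)) / σ) := by
        rw [← ENNReal.ofReal_inv_of_pos hσ0, ← ENNReal.ofReal_ofNat 3,
          ← ENNReal.ofReal_mul (by norm_num), ← ENNReal.ofReal_mul (by positivity)]
        congr 1
        ring
end

section
/- Let K be a finite nonempty set, T ∈ ℕ, η ∈ (0,1], and let r_1,…,r_T : K → [−1,1] be arbitrary reward functions. Define weights w_t(a) = exp(η · Σ_{s=1}^{t−1} r_s(a)) and probabilities π_t(a) = w_t(a) / Σ_{a' ∈ K} w_t(a'). Then for every a* ∈ K: Σ_{t=1}^{T} r_t(a*) − Σ_{t=1}^{T} Σ_{a ∈ K} π_t(a)·r_t(a) ≤ (log|K|)/η + η · Σ_{t=1}^{T} Σ_{a ∈ K} π_t(a)·r_t(a)^2. -/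
open Finset in
/-- Hedge weight at round `t` (rounds indexed from `0`, so `w t a` corresponds to the
weight `exp(η · Σ_{s=1}^{t} r_s(a))` of the `(t+1)`-st round). -/
noncomputable def hedgeW {K : Type*} [Fintype K] (η : ℝ) (r : ℕ → K → ℝ) (t : ℕ) (a : K) : ℝ :=
  Real.exp (η * ∑ s ∈ Finset.range t, r s a)

/-- Total Hedge weight `W_t`. -/
noncomputable def hedgeZ {K : Type*} [Fintype K] (η : ℝ) (r : ℕ → K → ℝ) (t : ℕ) : ℝ :=
  ∑ a, hedgeW η r t a

/-- Hedge probability `π_t(a) = w_t(a) / W_t`. -/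
noncomputable def hedgeProb {K : Type*} [Fintype K] (η : ℝ) (r : ℕ → K → ℝ) (t : ℕ) (a : K) : ℝ :=
  hedgeW η r t a / hedgeZ η r t

theorem hedgeW_pos {K : Type*} [Fintype K] (η : ℝ) (r : ℕ → K → ℝ) (t : ℕ) (a : K) :
    0 < hedgeW η r t a :=
  Real.exp_pos _

theorem hedgeZ_pos {K : Type*} [Fintype K] [Nonempty K] (η : ℝ) (r : ℕ → K → ℝ) (t : ℕ) :
    0 < hedgeZ η r t :=
  Finset.sum_pos (fun a _ => hedgeW_pos η r t a) Finset.univ_nonempty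

theorem hedgeW_succ {K : Type*} [Fintype K] (η : ℝ) (r : ℕ → K → ℝ) (t : ℕ) (a : K) :
    hedgeW η r (t + 1) a = hedgeW η r t a * Real.exp (η * r t a) := by
  simp only [hedgeW, Finset.sum_range_succ, mul_add, Real.exp_add]

theorem hedgeZ_mul_hedgeProb {K : Type*} [Fintype K] [Nonempty K] (η : ℝ) (r : ℕ → K → ℝ)
    (t : ℕ) (a : K) : hedgeZ η r t * hedgeProb η r t a = hedgeW η r t a :=
  mul_div_cancel₀ _ (hedgeZ_pos η r t).ne'

/-- One round multiplies the total weight by at most the exponential of the first two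
moments of the scaled reward. -/
theorem hedgeZ_succ_le {K : Type*} [Fintype K] [Nonempty K] (η : ℝ) (r : ℕ → K → ℝ) (t : ℕ)
    (h : ∀ a, |η * r t a| ≤ 1) :
    hedgeZ η r (t + 1) ≤ hedgeZ η r t *
      Real.exp (η * ∑ a, hedgeProb η r t a * r t a
        + η ^ 2 * ∑ a, hedgeProb η r t a * (r t a) ^ 2) := by
  calc hedgeZ η r (t + 1)
      ≤ ∑ a, hedgeW η r t a * (1 + η * r t a + (η * r t a) ^ 2) := by
        refine Finset.sum_le_sum fun a _ => ?_
        rw [hedgeW_succ]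
        have := (abs_le.mp (Real.abs_exp_sub_one_sub_id_le (h a))).2
        exact mul_le_mul_of_nonneg_left (by linarith) (hedgeW_pos η r t a).le
    _ = hedgeZ η r t * ((η * ∑ a, hedgeProb η r t a * r t a
          + η ^ 2 * ∑ a, hedgeProb η r t a * (r t a) ^ 2) + 1) := by
        rw [mul_add, mul_one]
        nth_rewrite 2 [hedgeZ]
        simp only [Finset.mul_sum, ← Finset.sum_add_distrib]
        refine Finset.sum_congr rfl fun a _ => ?_
        rw [← hedgeZ_mul_hedgeProb]
        ring
    _ ≤ _ := mul_le_mul_of_nonneg_left (Real.add_one_le_exp _) (hedgeZ_pos η r t).le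

theorem hedgeZ_le {K : Type*} [Fintype K] [Nonempty K] (η : ℝ) (r : ℕ → K → ℝ)
    (h : ∀ t a, |η * r t a| ≤ 1) (T : ℕ) :
    hedgeZ η r T ≤ Fintype.card K *
      Real.exp (η * ∑ t ∈ Finset.range T, ∑ a, hedgeProb η r t a * r t a
        + η ^ 2 * ∑ t ∈ Finset.range T, ∑ a, hedgeProb η r t a * (r t a) ^ 2) := by
  induction T with
  | zero => simp [hedgeZ, hedgeW]
  | succ n ih =>
    refine (hedgeZ_succ_le η r n (h n)).trans
      ((mul_le_mul_of_nonneg_right ih (Real.exp_pos _).le).trans_eq ?_)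
    rw [mul_assoc, ← Real.exp_add, Finset.sum_range_succ, Finset.sum_range_succ]
    ring_nf

/-- the regret bound for the Hedge algorithm with learning rate `η`:
for every expert `a⋆`, the cumulative reward of `a⋆` exceeds Hedge's expected
cumulative reward by at most `log|K|/η + η · Σ_t Σ_a π_t(a) r_t(a)²`. -/
theorem hedge_regret {K : Type*} [Fintype K] [Nonempty K] (T : ℕ) (η : ℝ)
    (hη : η ∈ Set.Ioc (0:ℝ) 1)
    (r : ℕ → K → ℝ) (hr : ∀ t, ∀ a : K, r t a ∈ Set.Icc (-1 : ℝ) 1) (astar : K) :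
    ∑ t ∈ Finset.range T, r t astar
        - ∑ t ∈ Finset.range T, ∑ a, hedgeProb η r t a * r t a
      ≤ Real.log (Fintype.card K) / η
        + η * ∑ t ∈ Finset.range T, ∑ a, hedgeProb η r t a * (r t a) ^ 2 := by
  obtain ⟨hη0, hη1⟩ := hη
  have hb : ∀ t a, |η * r t a| ≤ 1 := fun t a => by
    rw [abs_mul, abs_of_pos hη0]
    exact mul_le_one₀ hη1 (abs_nonneg _) (abs_le.mpr (hr t a))
  have hW : hedgeW η r T astar ≤ hedgeZ η r T :=
    Finset.single_le_sum (fun a _ => (hedgeW_pos η r T a).le) (Finset.mem_univ astar)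
  have hlog := Real.log_le_log (hedgeW_pos η r T astar) (hW.trans (hedgeZ_le η r hb T))
  rw [hedgeW, Real.log_exp, Real.log_mul (by simp) (Real.exp_pos _).ne', Real.log_exp] at hlog
  refine le_of_mul_le_mul_left ?_ hη0
  rw [mul_add, mul_div_cancel₀ _ hη0.ne']
  linarith
end

section
/- Let K be a finite nonempty set, T ∈ ℕ, η ∈ (0,1], and let r_1,…,r_T : K → [−1,1] be arbitrary reward functions. Define w_t(a) = exp(η · Σ_{s=1}^{t−1} r_s(a)), W_t = Σ_{a ∈ K} w_t(a), and π_t(a) = w_t(a)/W_t. Then for every 1 ≤ t ≤ T: log(W_{t+1}/W_t) ≤ η · Σ_{a ∈ K} π_t(a)·r_t(a) + η^2 · Σ_{a ∈ K} π_t(a)·r_t(a)^2. -/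
theorem hedgeProb_nonneg {K : Type*} [Fintype K] [Nonempty K] (η : ℝ) (r : ℕ → K → ℝ) (t : ℕ)
    (a : K) : 0 ≤ hedgeProb η r t a :=
  div_nonneg (Real.exp_pos _).le (hedgeZ_pos η r t).le

theorem sum_hedgeProb {K : Type*} [Fintype K] [Nonempty K] (η : ℝ) (r : ℕ → K → ℝ) (t : ℕ) :
    ∑ a, hedgeProb η r t a = 1 := by
  simp only [hedgeProb, ← Finset.sum_div]
  exact div_self (hedgeZ_pos η r t).ne'

theorem hedgeZ_succ_div {K : Type*} [Fintype K] (η : ℝ) (r : ℕ → K → ℝ) (t : ℕ) :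
    hedgeZ η r (t + 1) / hedgeZ η r t = ∑ a, hedgeProb η r t a * Real.exp (η * r t a) := by
  rw [hedgeZ, Finset.sum_div]
  exact Finset.sum_congr rfl fun a _ => by rw [hedgeW_succ, hedgeProb, div_mul_eq_mul_div]

/-- the one-step potential inequality in the Hedge analysis:
`log(W_{t+1}/W_t) ≤ η Σ_a π_t(a) r_t(a) + η² Σ_a π_t(a) r_t(a)²`. -/
theorem hedge_potential_step {K : Type*} [Fintype K] [Nonempty K] (T : ℕ) (η : ℝ)
    (hη : η ∈ Set.Ioc (0:ℝ) 1)
    (r : ℕ → K → ℝ) (hr : ∀ t, ∀ a : K, r t a ∈ Set.Icc (-1 : ℝ) 1)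
    (t : ℕ) (ht : t < T) :
    Real.log (hedgeZ η r (t + 1) / hedgeZ η r t)
      ≤ η * ∑ a, hedgeProb η r t a * r t a
        + η ^ 2 * ∑ a, hedgeProb η r t a * (r t a) ^ 2 := by
  have exp_le : ∀ a, Real.exp (η * r t a) ≤ 1 + η * r t a + (η * r t a) ^ 2 := fun a => by
    have h_abs : |η * r t a| ≤ 1 := by
      rw [abs_mul, abs_of_pos hη.1]
      exact mul_le_one₀ hη.2 (abs_nonneg _) (abs_le.mpr (hr t a))
    linarith [(abs_le.mp (Real.abs_exp_sub_one_sub_id_le h_abs)).2]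
  have sum_le : hedgeZ η r (t + 1) / hedgeZ η r t
      ≤ ∑ a, hedgeProb η r t a * (1 + η * r t a + (η * r t a) ^ 2) := by
    rw [hedgeZ_succ_div]
    exact Finset.sum_le_sum fun a _ =>
      mul_le_mul_of_nonneg_left (exp_le a) (hedgeProb_nonneg η r t a)
  have sum_eq : ∑ a, hedgeProb η r t a * (1 + η * r t a + (η * r t a) ^ 2)
      = 1 + (η * ∑ a, hedgeProb η r t a * r t a
        + η ^ 2 * ∑ a, hedgeProb η r t a * (r t a) ^ 2) := by
    rw [Finset.mul_sum, Finset.mul_sum, ← add_assoc]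
    nth_rewrite 2 [← sum_hedgeProb η r t]
    rw [← Finset.sum_add_distrib, ← Finset.sum_add_distrib]
    exact Finset.sum_congr rfl fun a _ => by ring
  linarith [Real.log_le_sub_one_of_pos (div_pos (hedgeZ_pos η r (t + 1)) (hedgeZ_pos η r t))]
end

section
/- For every m ∈ ℕ there exist m pairwise distinct points v_1,…,v_m ∈ [0,1]^2 such that for every sign vector y ∈ {−1,+1}^m there exists a monotone allocation region A with profit(A,v_i) ≥ 1/2 whenever y_i = +1 and profit(A,v_i) ≤ 0 whenever y_i = −1. In particular, with the constant witness s_i = 1/4, the class of profit functions {v ↦ profit(A,v) : A a monotone allocation region} γ-fat-shatters sets of arbitrary cardinality for every γ ≤ 1/4, so its γ-fat-shattering dimension is infinite. -/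
open MeasureTheory Set
open scoped Classical

/-- The smallest monotone allocation region containing the points `(t i, 3/4 + t i)`
for `i ∈ s`: the union of the north-west quadrants at these points. -/
def staircase {ι : Type*} (t : ι → ℝ) (s : Set ι) : Set (ℝ × ℝ) :=
  ⋃ i ∈ s, Set.Icc 0 (t i) ×ˢ Set.Icc (3 / 4 + t i) 1

section staircase

variable {ι : Type*} {t : ι → ℝ} {s : Set ι}

theorem mem_staircase {x : ℝ × ℝ} :
    x ∈ staircase t s ↔
      ∃ i ∈ s, (0 ≤ x.1 ∧ x.1 ≤ t i) ∧ 3 / 4 + t i ≤ x.2 ∧ x.2 ≤ 1 := by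
  simp only [staircase, Set.mem_iUnion, exists_prop, Set.mem_prod, Set.mem_Icc]

theorem isAllocRegion_staircase [Finite ι] (ht : ∀ i, t i ∈ Set.Icc (0 : ℝ) (1 / 4)) :
    IsAllocRegion (staircase t s) := by
  refine ⟨s.toFinite.isClosed_biUnion fun i _ => isClosed_Icc.prod isClosed_Icc, ?_, ?_⟩
  · intro x hx
    obtain ⟨i, -, ⟨h0, h1⟩, h2, h3⟩ := mem_staircase.1 hx
    obtain ⟨hi0, hi1⟩ := ht i
    exact ⟨⟨h0, by linarith⟩, by linarith, h3⟩
  · intro x hx y hy h1 h2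
    obtain ⟨i, hi, ⟨-, hx1⟩, hx2, -⟩ := mem_staircase.1 hx
    exact mem_staircase.2 ⟨i, hi, ⟨hy.1.1, h1.trans hx1⟩, hx2.trans h2, hy.2.2⟩

theorem profit_staircase_of_mem (ht : ∀ i, t i ∈ Set.Icc (0 : ℝ) (1 / 4)) {i : ι} (hi : i ∈ s) :
    profit (staircase t s) (t i, 3 / 4 + t i) = 3 / 4 := by
  obtain ⟨hi0, hi1⟩ := ht i
  have hmem : (t i, 3 / 4 + t i) ∈ staircase t s :=
    mem_staircase.2 ⟨i, hi, ⟨hi0, le_rfl⟩, le_rfl, by linarith⟩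
  have hp : IsGreatest {x : ℝ | x ∈ Set.Icc (0 : ℝ) 1 ∧ (x, 3 / 4 + t i) ∈ staircase t s}
      (t i) := by
    refine ⟨⟨⟨hi0, by linarith⟩, hmem⟩, ?_⟩
    rintro x ⟨-, hx⟩
    obtain ⟨j, -, ⟨-, h1⟩, h2, -⟩ := mem_staircase.1 hx
    linarith
  have hq : IsLeast {y : ℝ | y ∈ Set.Icc (0 : ℝ) 1 ∧ (t i, y) ∈ staircase t s}
      (3 / 4 + t i) := by
    refine ⟨⟨⟨by linarith, by linarith⟩, hmem⟩, ?_⟩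
    rintro y ⟨-, hy⟩
    obtain ⟨j, -, ⟨-, h1⟩, h2, -⟩ := mem_staircase.1 hy
    linarith
  rw [profit, buyerPay, sellerPay, if_pos hmem, if_pos hmem, hp.csSup_eq, hq.csInf_eq]
  ring

theorem profit_staircase_of_notMem (hinj : Function.Injective t) {i : ι} (hi : i ∉ s) :
    profit (staircase t s) (t i, 3 / 4 + t i) = 0 := by
  have hmem : (t i, 3 / 4 + t i) ∉ staircase t s := by
    intro h
    obtain ⟨j, hj, ⟨-, h1⟩, h2, -⟩ := mem_staircase.1 h
    have hij : t i = t j := le_antisymm h1 (by linarith)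
    exact hi (hinj hij ▸ hj)
  simp [profit, buyerPay, sellerPay, hmem]

end staircase

/-- the class of bilateral-trade profit functions fat-shatters arbitrarily
large finite sets of points (with witness level `1/4`, at every scale `γ ≤ 1/4`), so its
γ-fat-shattering dimension is infinite. -/
theorem fat_shattering_unbounded (m : ℕ) :
    ∃ v : Fin m → ℝ × ℝ, Function.Injective v ∧ (∀ i, v i ∈ square) ∧
      (∀ y : Fin m → Bool, ∃ A : Set (ℝ × ℝ), IsAllocRegion A ∧ ∀ i,
        (y i = true → 1/2 ≤ profit A (v i)) ∧
        (y i = false → profit A (v i) ≤ 0)) ∧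
      (∀ γ : ℝ, 0 < γ → γ ≤ 1/4 →
        ∀ y : Fin m → Bool, ∃ A : Set (ℝ × ℝ), IsAllocRegion A ∧ ∀ i,
          (y i = true → 1/4 + γ ≤ profit A (v i)) ∧
          (y i = false → profit A (v i) ≤ 1/4 - γ)) := by
  let t : Fin m → ℝ := fun i => 1 / 4 / ((i : ℝ) + 1)
  have ht : ∀ i, t i ∈ Set.Icc (0 : ℝ) (1 / 4) := fun i =>
    ⟨by positivity, div_le_self (by norm_num) (by simp)⟩
  have hinj : Function.Injective t := by
    intro i j h
    have hi : (0 : ℝ) < (i : ℝ) + 1 := by positivity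
    have hj : (0 : ℝ) < (j : ℝ) + 1 := by positivity
    have hij : (i : ℝ) = j := by
      simp only [t] at h
      rw [div_eq_div_iff hi.ne' hj.ne'] at h
      linarith
    exact Fin.ext (by exact_mod_cast hij)
  have key : ∀ y : Fin m → Bool, ∃ A : Set (ℝ × ℝ), IsAllocRegion A ∧ ∀ i,
      (y i = true → 1/2 ≤ profit A (t i, 3 / 4 + t i)) ∧
      (y i = false → profit A (t i, 3 / 4 + t i) ≤ 0) := by
    intro y
    refine ⟨staircase t {i | y i = true}, isAllocRegion_staircase ht, fun i => ⟨fun h => ?_,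
      fun h => ?_⟩⟩
    · rw [profit_staircase_of_mem ht (show i ∈ {i | y i = true} from h)]
      norm_num
    · rw [profit_staircase_of_notMem hinj (by simp [h])]
  refine ⟨fun i => (t i, 3 / 4 + t i), fun i j h => hinj (Prod.ext_iff.1 h).1, fun i => ?_,
    key, fun γ _ hγ y => ?_⟩
  · obtain ⟨h0, h1⟩ := ht i
    exact ⟨⟨h0, by linarith⟩, by linarith, by linarith⟩
  · obtain ⟨A, hA, h⟩ := key y
    exact ⟨A, hA, fun i => ⟨fun hi => by linarith [(h i).1 hi],
      fun hi => by linarith [(h i).2 hi]⟩⟩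
end

section
/- Let A ⊆ [0,1]^2 be a monotone (bilateral-trade) allocation region and define B = { v ∈ [0,1]^2 : f(v) ∈ A ∩ Q }. Then B is a joint-ads allocation region (closed and north-east monotone), and for every v ∈ [0,1]^2: profit(A, f(v)) ≤ (1/2)·rev(B, v). -/
open MeasureTheory Set
open scoped Classical

/-- A joint-ads allocation region: a closed subset of the unit square, closed in the
north-east direction. -/
def IsJointAdsRegion (B : Set (ℝ × ℝ)) : Prop :=
  IsClosed B ∧ B ⊆ square ∧
    ∀ x ∈ B, ∀ y ∈ square, x.1 ≤ y.1 → x.2 ≤ y.2 → y ∈ B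

/-- Joint-ads Myerson payment of agent 1. -/
noncomputable def jaPay1 (B : Set (ℝ × ℝ)) (v : ℝ × ℝ) : ℝ :=
  if v ∈ B then sInf {x : ℝ | x ∈ Set.Icc (0:ℝ) 1 ∧ (x, v.2) ∈ B} else 0

/-- Joint-ads Myerson payment of agent 2. -/
noncomputable def jaPay2 (B : Set (ℝ × ℝ)) (v : ℝ × ℝ) : ℝ :=
  if v ∈ B then sInf {y : ℝ | y ∈ Set.Icc (0:ℝ) 1 ∧ (v.1, y) ∈ B} else 0

/-- Joint-ads revenue. -/
noncomputable def rev (B : Set (ℝ × ℝ)) (v : ℝ × ℝ) : ℝ :=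
  jaPay1 B v + jaPay2 B v

/-- The affine bijection `f(x,y) = ((1-x)/2, (1+y)/2)` from `[0,1]²` onto `Q`. -/
noncomputable def fmap (v : ℝ × ℝ) : ℝ × ℝ := ((1 - v.1) / 2, (1 + v.2) / 2)

/-- The square `Q = [0,1/2] × [1/2,1]`. -/
def Qset : Set (ℝ × ℝ) := Set.Icc (0:ℝ) (1/2) ×ˢ Set.Icc (1/2:ℝ) 1

theorem fmap_mem_Qset {v : ℝ × ℝ} : fmap v ∈ Qset ↔ v ∈ square := by
  simp only [fmap, Qset, square, Set.mem_prod, Set.mem_Icc]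
  constructor <;> rintro ⟨⟨h1, h2⟩, h3, h4⟩ <;> refine ⟨⟨?_, ?_⟩, ?_, ?_⟩ <;> linarith

theorem Qset_subset_square : Qset ⊆ square :=
  Set.prod_mono (Set.Icc_subset_Icc_right (by norm_num)) (Set.Icc_subset_Icc_left (by norm_num))

theorem continuous_fmap : Continuous fmap := by
  unfold fmap
  fun_prop

theorem mem_fmap_preimage {A : Set (ℝ × ℝ)} {v : ℝ × ℝ} :
    v ∈ fmap ⁻¹' (A ∩ Qset) ↔ fmap v ∈ A ∧ v ∈ square := by
  rw [Set.mem_preimage, Set.mem_inter_iff, fmap_mem_Qset]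

/-- The pullback along `fmap` of an allocation region is a joint-ads allocation region. -/
theorem IsAllocRegion.isJointAdsRegion_preimage {A : Set (ℝ × ℝ)} (hA : IsAllocRegion A) :
    IsJointAdsRegion (fmap ⁻¹' (A ∩ Qset)) := by
  obtain ⟨hclosed, -, hmono⟩ := hA
  refine ⟨(hclosed.inter (isClosed_Icc.prod isClosed_Icc)).preimage continuous_fmap,
    fun v hv => (mem_fmap_preimage.1 hv).2, fun x hx y hy h1 h2 => mem_fmap_preimage.2 ⟨?_, hy⟩⟩
  refine hmono _ hx.1 _ (Qset_subset_square (fmap_mem_Qset.2 hy)) ?_ ?_ <;>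
    simp only [fmap] <;> linarith

/-- The seller payment is at least the image under `fmap` of the payment of agent 1. -/
theorem le_sellerPay_fmap {A : Set (ℝ × ℝ)} {v : ℝ × ℝ} (hv : v ∈ fmap ⁻¹' (A ∩ Qset)) :
    (1 - jaPay1 (fmap ⁻¹' (A ∩ Qset)) v) / 2 ≤ sellerPay A (fmap v) := by
  obtain ⟨hvA, hvs⟩ := mem_fmap_preimage.1 hv
  have key : 1 - 2 * sellerPay A (fmap v) ≤ jaPay1 (fmap ⁻¹' (A ∩ Qset)) v := by
    rw [jaPay1, if_pos hv, sellerPay, if_pos hvA]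
    refine le_csInf ⟨v.1, hvs.1, hv⟩ ?_
    rintro x ⟨⟨hx0, hx1⟩, hxB⟩
    have h := le_csSup (s := {x : ℝ | x ∈ Set.Icc (0 : ℝ) 1 ∧ (x, (fmap v).2) ∈ A})
      ⟨1, fun z hz => hz.1.2⟩
      (show (1 - x) / 2 ∈ _ from ⟨⟨by linarith, by linarith⟩, hxB.1⟩)
    linarith
  linarith

/-- The buyer payment is at most the image under `fmap` of the payment of agent 2. -/
theorem buyerPay_fmap_le {A : Set (ℝ × ℝ)} {v : ℝ × ℝ} (hv : v ∈ fmap ⁻¹' (A ∩ Qset)) :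
    buyerPay A (fmap v) ≤ (1 + jaPay2 (fmap ⁻¹' (A ∩ Qset)) v) / 2 := by
  obtain ⟨hvA, hvs⟩ := mem_fmap_preimage.1 hv
  have key : 2 * buyerPay A (fmap v) - 1 ≤ jaPay2 (fmap ⁻¹' (A ∩ Qset)) v := by
    rw [jaPay2, if_pos hv, buyerPay, if_pos hvA]
    refine le_csInf ⟨v.2, hvs.2, hv⟩ ?_
    rintro y ⟨⟨hy0, hy1⟩, hyB⟩
    have h := csInf_le (s := {y : ℝ | y ∈ Set.Icc (0 : ℝ) 1 ∧ ((fmap v).1, y) ∈ A})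
      ⟨0, fun z hz => hz.1.1⟩
      (show (1 + y) / 2 ∈ _ from ⟨⟨by linarith, by linarith⟩, hyB.1⟩)
    linarith
  linarith

/-- pulling back (the clipping to `Q` of) a bilateral-trade allocation
region along `f` yields a joint-ads allocation region whose revenue dominates twice the
bilateral-trade profit. -/
theorem bt_to_ja (A : Set (ℝ × ℝ)) (hA : IsAllocRegion A) :
    IsJointAdsRegion (fmap ⁻¹' (A ∩ Qset)) ∧
    ∀ v ∈ square, profit A (fmap v) ≤ (1/2) * rev (fmap ⁻¹' (A ∩ Qset)) v := by
  refine ⟨hA.isJointAdsRegion_preimage, fun v hv => ?_⟩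
  by_cases hvA : fmap v ∈ A
  · have hvB := mem_fmap_preimage.2 ⟨hvA, hv⟩
    have hs := le_sellerPay_fmap hvB
    have hb := buyerPay_fmap_le hvB
    rw [profit, rev]
    linarith
  · have hvB : v ∉ fmap ⁻¹' (A ∩ Qset) := fun h => hvA h.1
    simp only [profit, buyerPay, sellerPay, rev, jaPay1, jaPay2, if_neg hvA, if_neg hvB]
    norm_num
end

section
/- Let B ⊆ [0,1]^2 be a joint-ads allocation region and define A = f(B) = { f(v) : v ∈ B }. Then A is a monotone (bilateral-trade) allocation region contained in Q, and for every v ∈ [0,1]^2: profit(A, f(v)) = (1/2)·rev(B, v). -/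
open MeasureTheory Set
open scoped Classical

/-- Membership in the image of `fmap`, through the inverse affine map. -/
theorem mem_image_fmap {B : Set (ℝ × ℝ)} {p : ℝ × ℝ} :
    p ∈ fmap '' B ↔ (1 - 2 * p.1, 2 * p.2 - 1) ∈ B := by
  constructor
  · rintro ⟨v, hv, rfl⟩
    convert hv using 1
    ext <;> simp only [fmap] <;> ring
  · intro h
    refine ⟨_, h, ?_⟩
    ext <;> simp only [fmap] <;> ring

theorem fmap_mem_image_iff {B : Set (ℝ × ℝ)} {v : ℝ × ℝ} : fmap v ∈ fmap '' B ↔ v ∈ B := by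
  rw [mem_image_fmap]
  have h : ((1 - 2 * (fmap v).1, 2 * (fmap v).2 - 1) : ℝ × ℝ) = v := by
    ext <;> simp only [fmap] <;> ring
  rw [h]

theorem IsClosed.image_fmap {B : Set (ℝ × ℝ)} (hB : IsClosed B) : IsClosed (fmap '' B) := by
  have h : fmap '' B = (fun p : ℝ × ℝ => ((1 - 2 * p.1, 2 * p.2 - 1) : ℝ × ℝ)) ⁻¹' B :=
    Set.ext fun _ => mem_image_fmap
  rw [h]
  exact hB.preimage (by fun_prop)

theorem image_fmap_subset_Qset {B : Set (ℝ × ℝ)} (hB : B ⊆ square) : fmap '' B ⊆ Qset := by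
  rintro _ ⟨v, hv, rfl⟩
  obtain ⟨⟨h1, h2⟩, h3, h4⟩ := hB hv
  refine ⟨⟨?_, ?_⟩, ?_, ?_⟩ <;> simp only [fmap] <;> linarith

theorem IsJointAdsRegion.isAllocRegion_image_fmap {B : Set (ℝ × ℝ)} (hB : IsJointAdsRegion B) :
    IsAllocRegion (fmap '' B) := by
  obtain ⟨hc, hs, hm⟩ := hB
  refine ⟨hc.image_fmap, (image_fmap_subset_Qset hs).trans Qset_subset_square, ?_⟩
  rintro x hx y ⟨⟨h1, h2⟩, h3, h4⟩ hyx hxy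
  rw [mem_image_fmap] at hx ⊢
  obtain ⟨⟨k1, k2⟩, k3, k4⟩ := hs hx
  dsimp only at k1 k2 k3 k4
  refine hm _ hx _ ⟨⟨?_, ?_⟩, ?_, ?_⟩ ?_ ?_ <;> dsimp only <;> linarith

/-- If `v ∈ B`, the seller's payment in the image region is an affine image of agent 1's. -/
theorem sellerPay_image_fmap {B : Set (ℝ × ℝ)} (hB : B ⊆ square) {v : ℝ × ℝ} (hv : v ∈ B) :
    sellerPay (fmap '' B) (fmap v) = (1 - jaPay1 B v) / 2 := by
  rw [sellerPay, jaPay1, if_pos (fmap_mem_image_iff.2 hv), if_pos hv]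
  have hmem : ∀ x : ℝ, (x, (fmap v).2) ∈ fmap '' B ↔ (1 - 2 * x, v.2) ∈ B := fun x => by
    rw [mem_image_fmap, show 2 * (x, (fmap v).2).2 - 1 = v.2 by simp only [fmap]; ring]
  have hglb := isGLB_csInf (s := {x : ℝ | x ∈ Set.Icc (0:ℝ) 1 ∧ (x, v.2) ∈ B})
    ⟨v.1, (hB hv).1, hv⟩ ⟨0, fun _ h => h.1.1⟩
  refine IsLUB.csSup_eq ⟨?_, ?_⟩ ⟨(fmap v).1, ?_, ?_⟩
  · rintro x ⟨-, hx⟩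
    rw [hmem] at hx
    linarith [hglb.1 ⟨(hB hx).1, hx⟩]
  · intro b hb
    have := (le_isGLB_iff (b := 1 - 2 * b) hglb).2 fun x hx => by
      obtain ⟨⟨h0, h1⟩, hxB⟩ := hx
      have := mem_upperBounds.1 hb ((1 - x) / 2) ⟨⟨by linarith, by linarith⟩, (hmem _).2 (by
        rwa [show 1 - 2 * ((1 - x) / 2) = x by ring])⟩
      linarith
    linarith
  · exact (Qset_subset_square (image_fmap_subset_Qset hB (mem_image_of_mem _ hv))).1
  · exact mem_image_of_mem _ hv

/-- If `v ∈ B`, the buyer's payment in the image region is an affine image of agent 2's. -/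
theorem buyerPay_image_fmap {B : Set (ℝ × ℝ)} (hB : B ⊆ square) {v : ℝ × ℝ} (hv : v ∈ B) :
    buyerPay (fmap '' B) (fmap v) = (1 + jaPay2 B v) / 2 := by
  rw [buyerPay, jaPay2, if_pos (fmap_mem_image_iff.2 hv), if_pos hv]
  have hmem : ∀ y : ℝ, ((fmap v).1, y) ∈ fmap '' B ↔ (v.1, 2 * y - 1) ∈ B := fun y => by
    rw [mem_image_fmap, show 1 - 2 * ((fmap v).1, y).1 = v.1 by simp only [fmap]; ring]
  have hglb := isGLB_csInf (s := {y : ℝ | y ∈ Set.Icc (0:ℝ) 1 ∧ (v.1, y) ∈ B})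
    ⟨v.2, (hB hv).2, hv⟩ ⟨0, fun _ h => h.1.1⟩
  refine IsGLB.csInf_eq ⟨?_, ?_⟩ ⟨(fmap v).2, ?_, ?_⟩
  · rintro y ⟨-, hy⟩
    rw [hmem] at hy
    linarith [hglb.1 ⟨(hB hy).2, hy⟩]
  · intro b hb
    have := (le_isGLB_iff (b := 2 * b - 1) hglb).2 fun y hy => by
      obtain ⟨⟨h0, h1⟩, hyB⟩ := hy
      have := mem_lowerBounds.1 hb ((1 + y) / 2) ⟨⟨by linarith, by linarith⟩, (hmem _).2 (by
        rwa [show 2 * ((1 + y) / 2) - 1 = y by ring])⟩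
      linarith
    linarith
  · exact (Qset_subset_square (image_fmap_subset_Qset hB (mem_image_of_mem _ hv))).2
  · exact mem_image_of_mem _ hv

/-- the image under `f` of a joint-ads allocation region is a monotone
bilateral-trade allocation region contained in `Q`, whose profit is exactly half of the
joint-ads revenue. -/
theorem ja_to_bt (B : Set (ℝ × ℝ)) (hB : IsJointAdsRegion B) :
    IsAllocRegion (fmap '' B) ∧ fmap '' B ⊆ Qset ∧
    ∀ v ∈ square, profit (fmap '' B) (fmap v) = (1/2) * rev B v := by
  refine ⟨hB.isAllocRegion_image_fmap, image_fmap_subset_Qset hB.2.1, fun v _ => ?_⟩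
  by_cases hv : v ∈ B
  · rw [profit, rev, sellerPay_image_fmap hB.2.1 hv, buyerPay_image_fmap hB.2.1 hv]
    ring
  · have hv' : fmap v ∉ fmap '' B := fun h => hv (fmap_mem_image_iff.1 h)
    simp only [profit, rev, sellerPay, buyerPay, jaPay1, jaPay2, if_neg hv, if_neg hv']
    ring
end

section
/- Let B ⊆ [0,1]^2 be a closed set and let p1,p2 : [0,1]^2 → [0,1] satisfy p1(v) = p2(v) = 0 for all v ∉ B. Define, for agent i ∈ {1,2} with valuation vi and bids (b1,b2) ∈ [0,1]^2, the utility u_i(vi,(b1,b2)) = vi·1{(b1,b2) ∈ B} − p_i(b1,b2). Say the mechanism (B,p1,p2) is DSIC if for every i ∈ {1,2}, every valuation vi ∈ [0,1], and every bid profile, replacing agent i's bid by vi does not decrease u_i; say it is IR if u_i under truthful bidding by agent i is nonnegative for every valuation of i and every bid of the other agent. Then (B,p1,p2) is DSIC and IR if and only if B is a joint-ads allocation region (north-east monotone) and p1, p2 are the joint-ads Myerson payments of B. -/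
open MeasureTheory Set
open scoped Classical

/-- Utility of agent 1 in the joint-ads mechanism `(B, p1, ·)`. -/
noncomputable def jaU1 (B : Set (ℝ × ℝ)) (p1 : ℝ × ℝ → ℝ) (v1 : ℝ) (b : ℝ × ℝ) : ℝ :=
  v1 * (if b ∈ B then (1:ℝ) else 0) - p1 b

/-- Utility of agent 2 in the joint-ads mechanism `(B, ·, p2)`. -/
noncomputable def jaU2 (B : Set (ℝ × ℝ)) (p2 : ℝ × ℝ → ℝ) (v2 : ℝ) (b : ℝ × ℝ) : ℝ :=
  v2 * (if b ∈ B then (1:ℝ) else 0) - p2 b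

/-- DSIC for joint ads: bidding truthfully is dominant for each agent. -/
def JaDSIC (B : Set (ℝ × ℝ)) (p1 p2 : ℝ × ℝ → ℝ) : Prop :=
  (∀ v1 ∈ Set.Icc (0:ℝ) 1, ∀ b ∈ square, jaU1 B p1 v1 (v1, b.2) ≥ jaU1 B p1 v1 b) ∧
  (∀ v2 ∈ Set.Icc (0:ℝ) 1, ∀ b ∈ square, jaU2 B p2 v2 (b.1, v2) ≥ jaU2 B p2 v2 b)

/-- IR for joint ads: truthful utility is nonnegative against any bid of the other
agent. -/
def JaIR (B : Set (ℝ × ℝ)) (p1 p2 : ℝ × ℝ → ℝ) : Prop :=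
  (∀ v1 ∈ Set.Icc (0:ℝ) 1, ∀ b2 ∈ Set.Icc (0:ℝ) 1, jaU1 B p1 v1 (v1, b2) ≥ 0) ∧
  (∀ v2 ∈ Set.Icc (0:ℝ) 1, ∀ b1 ∈ Set.Icc (0:ℝ) 1, jaU2 B p2 v2 (b1, v2) ≥ 0)

/-- Single-bidder Myerson characterization: for a closed set `S` of winning bids in `[0,1]`,
truthfulness and individual rationality force `S` to be an upper set with threshold payments. -/
theorem threshold_characterization (S : Set ℝ) (p : ℝ → ℝ) (hS : IsClosed S)
    (hp : ∀ v ∈ Icc (0:ℝ) 1, 0 ≤ p v) (hp0 : ∀ v ∈ Icc (0:ℝ) 1, v ∉ S → p v = 0) :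
    ((∀ v ∈ Icc (0:ℝ) 1, ∀ b ∈ Icc (0:ℝ) 1,
          v * (if b ∈ S then (1:ℝ) else 0) - p b ≤ v * (if v ∈ S then (1:ℝ) else 0) - p v) ∧
        ∀ v ∈ Icc (0:ℝ) 1, 0 ≤ v * (if v ∈ S then (1:ℝ) else 0) - p v) ↔
      ((∀ x ∈ Icc (0:ℝ) 1, x ∈ S → ∀ y ∈ Icc (0:ℝ) 1, x ≤ y → y ∈ S) ∧
        ∀ v ∈ Icc (0:ℝ) 1, p v = if v ∈ S then sInf {x : ℝ | x ∈ Icc (0:ℝ) 1 ∧ x ∈ S} else 0) := by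
  have hbdd : BddBelow {x : ℝ | x ∈ Icc (0:ℝ) 1 ∧ x ∈ S} := ⟨0, fun x hx => hx.1.1⟩
  have hclosed : IsClosed {x : ℝ | x ∈ Icc (0:ℝ) 1 ∧ x ∈ S} := isClosed_Icc.inter hS
  constructor
  · rintro ⟨hd, hir⟩
    refine ⟨fun x hx hxS y hy hxy => ?_, fun v hv => ?_⟩
    · by_contra hyS
      have h1 := hd y hy x hx
      have h2 := hir x hx
      have h3 := hp0 y hy hyS
      simp only [hxS, hyS, if_true, if_false] at h1 h2
      have h4 : x = y := by linarith
      exact hyS (h4 ▸ hxS)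
    · split_ifs with hvS
      · have hm := hclosed.csInf_mem ⟨v, hv, hvS⟩ hbdd
        set m := sInf {x : ℝ | x ∈ Icc (0:ℝ) 1 ∧ x ∈ S} with hmdef
        have h1 := hd m hm.1 v hv
        have h2 := hd v hv m hm.1
        have h3 := hir m hm.1
        simp only [hvS, hm.2, if_true] at h1 h2 h3
        refine le_antisymm (by linarith) ?_
        by_contra! hlt
        have hp_nonneg := hp v hv
        obtain ⟨w, hw1, hw2⟩ := exists_between hlt
        have hw : w ∈ Icc (0:ℝ) 1 := ⟨by linarith, by linarith [hm.1.2]⟩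
        have hwS : w ∉ S := fun h => (csInf_le hbdd ⟨hw, h⟩).not_gt hw2
        have h4 := hd w hw v hv
        have h5 := hp0 w hw hwS
        simp only [hvS, hwS, if_true, if_false] at h4
        linarith
      · exact hp0 v hv hvS
  · rintro ⟨hmono, hpay⟩
    have hle : ∀ v ∈ Icc (0:ℝ) 1, v ∈ S → sInf {x : ℝ | x ∈ Icc (0:ℝ) 1 ∧ x ∈ S} ≤ v :=
      fun v hv hvS => csInf_le hbdd ⟨hv, hvS⟩
    refine ⟨fun v hv b hb => ?_, fun v hv => ?_⟩
    · rw [hpay v hv, hpay b hb]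
      by_cases hbS : b ∈ S <;> by_cases hvS : v ∈ S <;> simp only [hbS, hvS, if_true, if_false]
      · exact le_rfl
      · have hm := hclosed.csInf_mem ⟨b, hb, hbS⟩ hbdd
        have : v ≤ sInf {x : ℝ | x ∈ Icc (0:ℝ) 1 ∧ x ∈ S} := by
          by_contra! hlt
          exact hvS (hmono _ hm.1 hm.2 v hv hlt.le)
        linarith
      · linarith [hle v hv hvS]
      · exact le_rfl
    · rw [hpay v hv]
      by_cases hvS : v ∈ S <;> simp only [hvS, if_true, if_false]
      · linarith [hle v hv hvS]
      · simp

/-- a joint-ads mechanism is DSIC and IR if and only if its allocation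
region is north-east monotone and its payments are the joint-ads Myerson payments. -/
theorem ja_dsic_ir_characterization (B : Set (ℝ × ℝ)) (p1 p2 : ℝ × ℝ → ℝ)
    (hBclosed : IsClosed B) (hBsq : B ⊆ square)
    (hp1 : ∀ v ∈ square, p1 v ∈ Set.Icc (0:ℝ) 1)
    (hp2 : ∀ v ∈ square, p2 v ∈ Set.Icc (0:ℝ) 1)
    (hp10 : ∀ v ∈ square, v ∉ B → p1 v = 0)
    (hp20 : ∀ v ∈ square, v ∉ B → p2 v = 0) :
    (JaDSIC B p1 p2 ∧ JaIR B p1 p2) ↔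
      ((∀ x ∈ B, ∀ y ∈ square, x.1 ≤ y.1 → x.2 ≤ y.2 → y ∈ B) ∧
        ∀ v ∈ square, p1 v = jaPay1 B v ∧ p2 v = jaPay2 B v) := by
  have h1 : ∀ y ∈ Icc (0:ℝ) 1, _ := fun y hy =>
    threshold_characterization {x | (x, y) ∈ B} (fun x => p1 (x, y))
      (hBclosed.preimage (by fun_prop)) (fun x hx => (hp1 (x, y) ⟨hx, hy⟩).1)
      (fun x hx => hp10 (x, y) ⟨hx, hy⟩)
  have h2 : ∀ x ∈ Icc (0:ℝ) 1, _ := fun x hx =>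
    threshold_characterization {y | (x, y) ∈ B} (fun y => p2 (x, y))
      (hBclosed.preimage (by fun_prop)) (fun y hy => (hp2 (x, y) ⟨hx, hy⟩).1)
      (fun y hy => hp20 (x, y) ⟨hx, hy⟩)
  constructor
  · rintro ⟨⟨hd1, hd2⟩, hir1, hir2⟩
    have t1 := fun y hy => (h1 y hy).1
      ⟨fun v hv b hb => hd1 v hv (b, y) ⟨hb, hy⟩, fun v hv => hir1 v hv y hy⟩
    have t2 := fun x hx => (h2 x hx).1
      ⟨fun v hv b hb => hd2 v hv (x, b) ⟨hx, hb⟩, fun v hv => hir2 v hv x hx⟩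
    refine ⟨fun x hx y hy hxy1 hxy2 => ?_, fun v hv =>
      ⟨(t1 v.2 hv.2).2 v.1 hv.1, (t2 v.1 hv.1).2 v.2 hv.2⟩⟩
    have hxs := hBsq hx
    exact (t2 y.1 hy.1).1 x.2 hxs.2 ((t1 x.2 hxs.2).1 x.1 hxs.1 hx y.1 hy.1 hxy1) y.2 hy.2 hxy2
  · rintro ⟨hmono, hpay⟩
    have t1 := fun y hy => (h1 y hy).2
      ⟨fun a ha haB b hb hab => hmono (a, y) haB (b, y) ⟨hb, hy⟩ hab le_rfl,
        fun v hv => (hpay (v, y) ⟨hv, hy⟩).1⟩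
    have t2 := fun x hx => (h2 x hx).2
      ⟨fun a ha haB b hb hab => hmono (x, a) haB (x, b) ⟨hx, hb⟩ le_rfl hab,
        fun v hv => (hpay (x, v) ⟨hx, hv⟩).2⟩
    exact ⟨⟨fun v hv b hb => (t1 b.2 hb.2).1 v hv b.1 hb.1,
        fun v hv b hb => (t2 b.1 hb.1).1 v hv b.2 hb.2⟩,
      fun v hv y hy => (t1 y hy).2 v hv, fun v hv x hx => (t2 x hx).2 v hv⟩
end
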